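/- For every positive integer n, there exists a tournament T of order n with inv(T) ≥ n − (2 + √(2(n·log₂ n + n + 2))). -/

import Mathlib

/-- An oriented graph: a digraph with no loops and no pair of opposite arcs. -/
structure OrientedGraph (V : Type*) where
  arc : V → V → Prop
  irrefl' : ∀ v, ¬ arc v v
  asymm' : ∀ u v, arc u v → ¬ arc v u

namespace OrientedGraph

variable {V : Type*}

/-- An oriented graph is acyclic if it has no directed cycle. -/
def IsAcyclic (D : OrientedGraph V) : Prop := ∀ v, ¬ Relation.TransGen D.arc v v

/-- The result of inverting the sets `X 0, …, X (k-1)` one after another: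
an arc is reversed iff an odd number of the sets contain both of its end-vertices. -/
def invert (D : OrientedGraph V) {k : ℕ} (X : Fin k → Set V) : OrientedGraph V where
  arc u v := (Even {i : Fin k | u ∈ X i ∧ v ∈ X i}.ncard ∧ D.arc u v) ∨
    (¬ Even {i : Fin k | u ∈ X i ∧ v ∈ X i}.ncard ∧ D.arc v u)
  irrefl' v h := by
    rcases h with ⟨_, h⟩ | ⟨_, h⟩ <;> exact D.irrefl' v h
  asymm' u v h1 h2 := by
    have hs : {i : Fin k | v ∈ X i ∧ u ∈ X i} = {i : Fin k | u ∈ X i ∧ v ∈ X i} := by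
      ext i; simp only [Set.mem_setOf_eq]; exact and_comm
    rcases h1 with ⟨hE, h1⟩ | ⟨hE, h1⟩ <;> rcases h2 with ⟨hE', h2⟩ | ⟨hE', h2⟩ <;>
      rw [hs] at hE'
    · exact D.asymm' u v h1 h2
    · exact hE' hE
    · exact hE hE'
    · exact D.asymm' v u h1 h2

/-- A family of subsets is decycling if inverting it yields an acyclic oriented graph. -/
def IsDecycling (D : OrientedGraph V) {k : ℕ} (X : Fin k → Set V) : Prop :=
  (D.invert X).IsAcyclic

/-- The inversion number: the minimum cardinality of a decycling family. -/
noncomputable def inv (D : OrientedGraph V) : ℕ :=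
  sInf {k | ∃ X : Fin k → Set V, D.IsDecycling X}

/-- A tournament: an oriented graph whose underlying graph is complete. -/
def IsTournament (D : OrientedGraph V) : Prop :=
  ∀ u v : V, u ≠ v → D.arc u v ∨ D.arc v u

/-- The subdigraph induced by a set of vertices. -/
def induce (D : OrientedGraph V) (S : Set V) : OrientedGraph S where
  arc a b := D.arc a b
  irrefl' a := D.irrefl' a
  asymm' a b := D.asymm' a b

/-- The dijoin `L ⇒ R`: disjoint union of `L` and `R` plus all arcs from `L` to `R`. -/
def dijoin {α β : Type*} (L : OrientedGraph α) (R : OrientedGraph β) :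
    OrientedGraph (α ⊕ β) where
  arc x y :=
    match x, y with
    | Sum.inl a, Sum.inl b => L.arc a b
    | Sum.inl _, Sum.inr _ => True
    | Sum.inr _, Sum.inl _ => False
    | Sum.inr a, Sum.inr b => R.arc a b
  irrefl' x := by
    cases x with
    | inl a => exact L.irrefl' a
    | inr b => exact R.irrefl' b
  asymm' x y := by
    cases x <;> cases y
    · exact L.asymm' _ _
    · exact fun _ h => h
    · exact fun h _ => h
    · exact R.asymm' _ _

/-- The oriented graph `△(D)`, obtained from `D` by adding two new vertices `u = inr false`
and `v = inr true`, all arcs from `V(D)` to `u`, the arc `u v`, and all arcs from `v`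
to `V(D)`. -/
def triangleExt (D : OrientedGraph V) : OrientedGraph (V ⊕ Bool) where
  arc x y :=
    match x, y with
    | Sum.inl a, Sum.inl b => D.arc a b
    | Sum.inl _, Sum.inr w => w = false
    | Sum.inr w, Sum.inl _ => w = true
    | Sum.inr w, Sum.inr w' => w = false ∧ w' = true
  irrefl' x := by
    cases x with
    | inl a => exact D.irrefl' a
    | inr w => exact fun h => absurd (h.1.symm.trans h.2) (by decide)
  asymm' x y := by
    cases x <;> cases y <;> intro h1 h2
    · exact D.asymm' _ _ h1 h2
    · exact absurd (h1.symm.trans h2) (by decide)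
    · exact absurd (h2.symm.trans h1) (by decide)
    · exact absurd (h1.2.symm.trans h2.1) (by decide)

end OrientedGraph

/-- `maxInv n` is the maximum of the inversion numbers of tournaments of order `n`. -/
noncomputable def maxInv (n : ℕ) : ℕ :=
  sSup {m | ∃ T : OrientedGraph (Fin n), T.IsTournament ∧ T.inv = m}

namespace OrientedGraph

lemma pow_add_mul_self_le_add_pow (n : ℕ) (hn : 1 ≤ n) : n ^ n + n ^ n ≤ (n + 1) ^ n := by
  rcases n with _ | m
  · omega
  · rw [add_pow (m + 1) 1 (m + 1), Finset.sum_range_succ, Finset.sum_range_succ]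
    simp only [one_pow, mul_one, Nat.choose_self, Nat.cast_one, Nat.choose_succ_self_right]
    have : (m + 1) ^ m * (m + 1) = (m + 1) ^ (m + 1) := by ring
    rw [Nat.cast_id, this]
    omega

/-- Every oriented graph on `Fin n` has a decycling family. -/
lemma exists_decycling {n : ℕ} (T : OrientedGraph (Fin n)) :
    ∃ k, ∃ X : Fin k → Set (Fin n), T.IsDecycling X := by
  classical
  let X : Fin (n * n) → Set (Fin n) := fun i =>
    {w | (w = (finProdFinEquiv.symm i).1 ∨ w = (finProdFinEquiv.symm i).2) ∧
      (finProdFinEquiv.symm i).1 < (finProdFinEquiv.symm i).2 ∧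
      T.arc (finProdFinEquiv.symm i).2 (finProdFinEquiv.symm i).1}
  refine ⟨n * n, X, ?_⟩
  have key : ∀ x y, (T.invert X).arc x y → x < y := by
    intro x y h
    by_contra hlt
    have hne : x ≠ y := by
      rintro rfl
      exact (T.invert X).irrefl' _ h
    have hyx : y < x := lt_of_le_of_ne (not_lt.mp hlt) hne.symm
    rcases h with ⟨hE, h⟩ | ⟨hE, h⟩
    · have : {i : Fin (n * n) | x ∈ X i ∧ y ∈ X i} = {finProdFinEquiv (y, x)} := by
        ext i
        obtain ⟨⟨a, b⟩, rfl⟩ := finProdFinEquiv.surjective i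
        simp only [X, Set.mem_setOf_eq, Equiv.symm_apply_apply, Set.mem_singleton_iff,
          EmbeddingLike.apply_eq_iff_eq, Prod.mk.injEq]
        constructor
        · rintro ⟨⟨h1, h2, h3⟩, h4, -⟩
          rcases h1 with rfl | rfl <;> rcases h4 with rfl | rfl
          · exact absurd rfl hne
          · exact absurd h2 (not_lt.mpr hyx.le)
          · exact ⟨rfl, rfl⟩
          · exact absurd rfl hne
        · rintro ⟨rfl, rfl⟩
          exact ⟨⟨Or.inr rfl, hyx, h⟩, Or.inl rfl, hyx, h⟩
      rw [this, Set.ncard_singleton] at hE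
      exact absurd hE (by decide)
    · have : {i : Fin (n * n) | x ∈ X i ∧ y ∈ X i} = ∅ := by
        ext i
        obtain ⟨⟨a, b⟩, rfl⟩ := finProdFinEquiv.surjective i
        simp only [X, Set.mem_setOf_eq, Equiv.symm_apply_apply, Set.mem_empty_iff_false, iff_false]
        rintro ⟨⟨h1, h2, h3⟩, h4, -⟩
        rcases h1 with rfl | rfl <;> rcases h4 with rfl | rfl
        · exact absurd rfl hne
        · exact absurd h2 (not_lt.mpr hyx.le)
        · exact T.asymm' _ _ h h3
        · exact absurd rfl hne
      rw [this, Set.ncard_empty] at hE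
      exact hE (by decide)
  intro v hv
  have : ∀ a b, Relation.TransGen (T.invert X).arc a b → a < b := by
    intro a b hab
    induction hab with
    | single h => exact key _ _ h
    | tail _ h ih => exact ih.trans (key _ _ h)
  exact lt_irrefl _ (this v v hv)

/-- An acyclic tournament is a linear order. -/
lemma exists_perm {n : ℕ} (T : OrientedGraph (Fin n)) (hT : T.IsTournament)
    (hA : T.IsAcyclic) : ∃ π : Equiv.Perm (Fin n), ∀ u v, T.arc u v ↔ π u < π v := by
  classical
  have tr : ∀ u v w, T.arc u v → T.arc v w → T.arc u w := by
    intro u v w h1 h2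
    have hne : u ≠ w := by
      rintro rfl
      exact T.asymm' _ _ h1 h2
    rcases hT u w hne with h | h
    · exact h
    · exact absurd (((Relation.TransGen.single h1).tail h2).tail h) (hA u)
  let P : Fin n → Finset (Fin n) := fun u => Finset.univ.filter (fun w => T.arc w u)
  have hP : ∀ u, (P u).card < n := by
    intro u
    have : (P u).card < (Finset.univ : Finset (Fin n)).card := by
      apply Finset.card_lt_card
      rw [Finset.ssubset_univ_iff]
      intro h
      have : u ∈ P u := by rw [h]; simp
      exact T.irrefl' u (Finset.mem_filter.mp this).2
    simpa using this
  have hmono : ∀ u v, T.arc u v → (P u).card < (P v).card := by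
    intro u v h
    apply Finset.card_lt_card
    rw [Finset.ssubset_iff_of_subset]
    · exact ⟨u, by simp [P, h], by simp [P, T.irrefl' u]⟩
    · intro w hw
      simp only [P, Finset.mem_filter, Finset.mem_univ, true_and] at hw ⊢
      exact tr _ _ _ hw h
  let r : Fin n → Fin n := fun u => ⟨(P u).card, hP u⟩
  have hr : Function.Injective r := by
    intro u v huv
    by_contra hne
    have he : (P u).card = (P v).card := by simpa [r] using huv
    rcases hT u v hne with h | h
    · exact absurd (hmono _ _ h) (by omega)
    · exact absurd (hmono _ _ h) (by omega)
  refine ⟨Equiv.ofBijective r (Finite.injective_iff_bijective.mp hr), fun u v => ?_⟩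
  simp only [Equiv.ofBijective_apply]
  constructor
  · intro h
    exact hmono _ _ h
  · intro h
    have hne : u ≠ v := by
      rintro rfl
      exact lt_irrefl _ h
    rcases hT u v hne with h' | h'
    · exact h'
    · exact absurd (hmono _ _ h') (not_lt.mpr (le_of_lt h))

lemma invert_isTournament {V : Type*} (T : OrientedGraph V) (hT : T.IsTournament) {k : ℕ}
    (X : Fin k → Set V) : (T.invert X).IsTournament := by
  intro u v huv
  have hs : {i : Fin k | v ∈ X i ∧ u ∈ X i} = {i : Fin k | u ∈ X i ∧ v ∈ X i} := by
    ext i; simp only [Set.mem_setOf_eq]; exact and_comm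
  simp only [invert, hs]
  have := hT u v huv
  tauto

/-- The tournament encoded by a Boolean function on unordered pairs. -/
def ofFun {n : ℕ} (f : {p : Sym2 (Fin n) // ¬ p.IsDiag} → Bool) : OrientedGraph (Fin n) where
  arc u v := ∃ h : u ≠ v, (f ⟨s(u, v), by simpa using h⟩ = true ↔ u < v)
  irrefl' v h := h.1 rfl
  asymm' u v h1 h2 := by
    obtain ⟨h, h1⟩ := h1
    obtain ⟨h', h2⟩ := h2
    have e : (⟨s(v, u), by simpa using h'⟩ : {p : Sym2 (Fin n) // ¬ p.IsDiag}) =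
      ⟨s(u, v), by simpa using h⟩ := Subtype.ext Sym2.eq_swap
    rw [e] at h2
    rcases lt_or_gt_of_ne h with h3 | h3
    · exact lt_asymm h3 (h2.mp (h1.mpr h3))
    · exact lt_asymm h3 (h1.mp (h2.mpr h3))

lemma ofFun_isTournament {n : ℕ} (f : {p : Sym2 (Fin n) // ¬ p.IsDiag} → Bool) :
    (ofFun f).IsTournament := by
  intro u v h
  have e : (⟨s(v, u), by simpa using h.symm⟩ : {p : Sym2 (Fin n) // ¬ p.IsDiag}) =
      ⟨s(u, v), by simpa using h⟩ := Subtype.ext Sym2.eq_swap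
  by_cases hf : f ⟨s(u, v), by simpa using h⟩ = true
  · rcases lt_or_gt_of_ne h with h3 | h3
    · exact Or.inl ⟨h, by simp [hf, h3]⟩
    · exact Or.inr ⟨h.symm, by rw [e]; simp [hf, h3]⟩
  · rcases lt_or_gt_of_ne h with h3 | h3
    · exact Or.inr ⟨h.symm, by rw [e]; simp [hf, h3.le]⟩
    · exact Or.inl ⟨h, by simp [hf, h3.le]⟩

lemma ofFun_inj {n : ℕ} (f g : {p : Sym2 (Fin n) // ¬ p.IsDiag} → Bool)
    (h : ∀ u v, u ≠ v → ((ofFun f).arc u v ↔ (ofFun g).arc u v)) : f = g := by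
  funext ⟨p, hp⟩
  induction p using Sym2.ind with
  | _ u v =>
    have huv : u ≠ v := by simpa using hp
    have := h u v huv
    simp only [ofFun, huv, ne_eq, not_false_eq_true, exists_true_left] at this
    rw [Bool.eq_iff_iff]
    tauto

/-- The data encoding a symmetric matrix of rank at most `k`. -/
abbrev GData (n k : ℕ) : Type :=
  Σ S : {S : Finset (Fin n) // S.card = k},
    (Sym2 S.1 → ZMod 2) × ({j : Fin n // j ∉ S.1} → S.1 → ZMod 2)

/-- The extended coefficients. -/
def GData.coef {n k : ℕ} (d : GData n k) (u : Fin n) (a : d.1.1) : ZMod 2 :=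
  if h : u ∈ d.1.1 then (if a = ⟨u, h⟩ then 1 else 0) else d.2.2 ⟨u, h⟩ a

/-- The matrix encoded by the data. -/
def GData.mat {n k : ℕ} (d : GData n k) (u v : Fin n) : ZMod 2 :=
  ∑ a, ∑ b, d.coef u a * d.coef v b * d.2.1 s(a, b)

lemma exists_subset {n m k : ℕ} (hmk : m ≤ k) (hkn : k ≤ n) (a : Fin n → (Fin m → ZMod 2)) :
    ∃ S : Finset (Fin n), S.card = k ∧
      ∀ j, ∃ c : S → ZMod 2, ∑ i, c i • a i = a j := by
  classical
  obtain ⟨κ, b, hb, hspan, hli⟩ := exists_linearIndependent' (ZMod 2) a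
  have : Fintype κ := Fintype.ofInjective b hb
  have hc : Fintype.card κ ≤ m := by
    have := hli.fintype_card_le_finrank
    simpa using this
  obtain ⟨S, hS, hScard⟩ := Finset.exists_superset_card_eq (s := Finset.univ.image b) (n := k)
    (by rw [Finset.card_image_of_injective _ hb, Finset.card_univ]; omega) (by simpa using hkn)
  refine ⟨S, hScard, fun j => ?_⟩
  have h1 : a j ∈ Submodule.span (ZMod 2) (Set.range (a ∘ b)) := by
    rw [hspan]; exact Submodule.subset_span ⟨j, rfl⟩
  have h2 : a j ∈ Submodule.span (ZMod 2) (Set.range (fun i : S => a i)) := by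
    refine Submodule.span_mono ?_ h1
    rintro _ ⟨x, rfl⟩
    exact ⟨⟨b x, hS (by simp)⟩, rfl⟩
  exact (Submodule.mem_span_range_iff_exists_fun (ZMod 2)).mp h2

lemma exists_data {n m k : ℕ} (hmk : m ≤ k) (hkn : k ≤ n) (a : Fin n → (Fin m → ZMod 2)) :
    ∃ d : GData n k, ∀ u v, d.mat u v = a u ⬝ᵥ a v := by
  classical
  obtain ⟨S, hS, hc⟩ := exists_subset hmk hkn a
  choose c hc using hc
  let d : GData n k := ⟨⟨S, hS⟩, Sym2.lift ⟨fun x y => a x ⬝ᵥ a y, fun x y => dotProduct_comm _ _⟩,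
    fun j => c j.1⟩
  have hd : ∀ u, ∑ i : S, d.coef u i • a i = a u := by
    intro u
    by_cases hu : u ∈ S
    · have : ∀ i : S, d.coef u i = if i = ⟨u, hu⟩ then 1 else 0 := by
        intro i
        simp only [GData.coef, d, hu, dif_pos]
      simp [this]
    · have : ∀ i : S, d.coef u i = c u i := by
        intro i
        simp only [GData.coef, d, hu, dif_neg, not_false_eq_true]
      simp only [this, hc]
  refine ⟨d, fun u v => ?_⟩
  conv_rhs => rw [← hd u, ← hd v]
  rw [sum_dotProduct]
  simp only [dotProduct_sum, smul_dotProduct, dotProduct_smul, smul_eq_mul]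
  simp only [GData.mat, d, Sym2.lift_mk]
  refine Finset.sum_congr rfl fun x _ => Finset.sum_congr rfl fun y _ => ?_
  ring

lemma card_GData (n k : ℕ) : Fintype.card (GData n k) =
    n.choose k * (2 ^ ((k + 1).choose 2) * 2 ^ (k * (n - k))) := by
  classical
  rw [Fintype.card_sigma]
  have : ∀ S : {S : Finset (Fin n) // S.card = k},
      Fintype.card ((Sym2 S.1 → ZMod 2) × ({j : Fin n // j ∉ S.1} → S.1 → ZMod 2)) =
      2 ^ ((k + 1).choose 2) * 2 ^ (k * (n - k)) := by
    intro S
    have h1 : Fintype.card {j : Fin n // j ∉ S.1} = n - k := by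
      rw [Fintype.card_subtype_compl]; simp [S.2]
    rw [Fintype.card_prod, Fintype.card_fun, Fintype.card_fun, Fintype.card_fun, ZMod.card,
      Sym2.card, h1, Fintype.card_coe, S.2, pow_mul]
  rw [Finset.sum_congr rfl (fun S _ => this S), Finset.sum_const, Finset.card_univ,
    Fintype.card_finset_len, Fintype.card_fin, smul_eq_mul]

lemma exists_code {n k : ℕ} (hkn : k ≤ n) (T : OrientedGraph (Fin n)) (hT : T.IsTournament)
    (hk : T.inv ≤ k) : ∃ d : Equiv.Perm (Fin n) × GData n k, ∀ u v, u ≠ v →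
      (T.arc u v ↔ (d.2.mat u v = 0 ↔ d.1 u < d.1 v)) := by
  classical
  obtain ⟨X, hX⟩ : ∃ X : Fin T.inv → Set (Fin n), T.IsDecycling X :=
    Nat.sInf_mem (s := {k | ∃ X : Fin k → Set (Fin n), T.IsDecycling X}) (exists_decycling T)
  obtain ⟨π, hπ⟩ := exists_perm _ (invert_isTournament T hT X) hX
  obtain ⟨d, hd⟩ := exists_data hk hkn (fun u i => if u ∈ X i then (1 : ZMod 2) else 0)
  refine ⟨(π, d), fun u v huv => ?_⟩
  have h0 : d.mat u v = 0 ↔ Even {i | u ∈ X i ∧ v ∈ X i}.ncard := by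
    rw [hd, ← ZMod.natCast_eq_zero_iff_even, Set.ncard_eq_toFinset_card']
    have : (fun i => if u ∈ X i then (1 : ZMod 2) else 0) ⬝ᵥ
        (fun i => if v ∈ X i then (1 : ZMod 2) else 0) =
        (({i | u ∈ X i ∧ v ∈ X i} : Set (Fin T.inv)).toFinset.card : ZMod 2) := by
      simp [dotProduct, ← ite_and, Finset.sum_ite, Set.toFinset_setOf, and_comm]
    rw [this]
  show T.arc u v ↔ (d.mat u v = 0 ↔ π u < π v)
  rw [h0, ← hπ]
  simp only [invert]
  have h1 := hT u v huv
  have h2 := T.asymm' u v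
  tauto

lemma counting {n k : ℕ} (hkn : k ≤ n)
    (h : ∀ T : OrientedGraph (Fin n), T.IsTournament → T.inv ≤ k) :
    2 ^ (n.choose 2) ≤ n.factorial *
      (n.choose k * (2 ^ ((k + 1).choose 2) * 2 ^ (k * (n - k)))) := by
  classical
  have hex := fun f : {p : Sym2 (Fin n) // ¬ p.IsDiag} → Bool =>
    exists_code hkn (ofFun f) (ofFun_isTournament f) (h _ (ofFun_isTournament f))
  choose F hF using hex
  have hinj : Function.Injective F := by
    intro f g hfg
    apply ofFun_inj
    intro u v huv
    rw [hF f u v huv, hF g u v huv, hfg]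
  have := Fintype.card_le_of_injective F hinj
  rw [Fintype.card_prod, card_GData, Fintype.card_perm, Fintype.card_fun, Fintype.card_bool,
    Sym2.card_subtype_not_diag, Fintype.card_fin] at this
  exact this

lemma two_pow_factorial (n : ℕ) (hn : 1 ≤ n) : 2 ^ n * n.factorial ≤ 2 * n ^ n := by
  induction n, hn using Nat.le_induction with
  | base => simp
  | succ n hn ih =>
    have hb : 2 * n ^ n ≤ (n + 1) ^ n := by
      have h := pow_add_mul_self_le_add_pow n hn
      linarith
    calc 2 ^ (n + 1) * (n + 1).factorial = 2 * (n + 1) * (2 ^ n * n.factorial) := by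
          rw [Nat.factorial_succ]; ring
      _ ≤ 2 * (n + 1) * (2 * n ^ n) := Nat.mul_le_mul_left _ ih
      _ ≤ 2 * (n + 1) * (n + 1) ^ n := Nat.mul_le_mul_left _ hb
      _ = 2 * (n + 1) ^ (n + 1) := by ring

end OrientedGraph

theorem exists_tournament_inv_ge (n : ℕ) (hn : 1 ≤ n) :
    ∃ T : OrientedGraph (Fin n), T.IsTournament ∧
      (n : ℝ) - (2 + Real.sqrt (2 * ((n : ℝ) * Real.logb 2 (n : ℝ) + (n : ℝ) + 2)))
        ≤ (T.inv : ℝ) := by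
  set s := Real.sqrt (2 * ((n : ℝ) * Real.logb 2 (n : ℝ) + (n : ℝ) + 2)) with hs
  have hn1 : (1 : ℝ) ≤ n := by exact_mod_cast hn
  have hlog : 0 ≤ Real.logb 2 (n : ℝ) := Real.logb_nonneg (by norm_num) hn1
  have hs0 : 0 ≤ s := Real.sqrt_nonneg _
  have hsq : s ^ 2 = 2 * ((n : ℝ) * Real.logb 2 (n : ℝ) + (n : ℝ) + 2) :=
    Real.sq_sqrt (by positivity)
  by_contra! hcon
  have hpos : 0 < (n : ℝ) - (2 + s) :=
    lt_of_le_of_lt (Nat.cast_nonneg _) (hcon _ (OrientedGraph.ofFun_isTournament fun _ => true))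
  obtain ⟨k, hk1, hk2⟩ : ∃ k : ℕ, (k : ℝ) < n - (2 + s) ∧ (n : ℝ) - (2 + s) ≤ k + 1 := by
    have h1 : 0 < ⌈(n : ℝ) - (2 + s)⌉₊ := Nat.ceil_pos.mpr hpos
    refine ⟨⌈(n : ℝ) - (2 + s)⌉₊ - 1, Nat.lt_ceil.mp (by omega), ?_⟩
    have := Nat.le_ceil ((n : ℝ) - (2 + s))
    rw [Nat.cast_sub h1]; push_cast; linarith
  have hkn : k ≤ n := by
    have : (k : ℝ) ≤ n := by linarith
    exact_mod_cast this
  have hle := OrientedGraph.counting hkn (fun T hT => by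
    have h2 := hcon T hT
    have : (T.inv : ℝ) < (k + 1 : ℕ) := by push_cast; linarith
    have : T.inv < k + 1 := by exact_mod_cast this
    omega)
  have hle2 : 2 ^ (n.choose 2) ≤ 2 * n ^ n * (2 ^ ((k + 1).choose 2) * 2 ^ (k * (n - k))) := by
    refine hle.trans ?_
    rw [← mul_assoc]
    refine Nat.mul_le_mul_right _ ?_
    refine le_trans ?_ (OrientedGraph.two_pow_factorial n hn)
    rw [mul_comm]
    exact Nat.mul_le_mul_right _ (Nat.choose_le_two_pow _ _)
  have hle3 : (2 : ℝ) ^ (n.choose 2) ≤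
      2 * (n : ℝ) ^ n * (2 ^ ((k + 1).choose 2) * 2 ^ (k * (n - k))) := by exact_mod_cast hle2
  have hn0 : (n : ℝ) ≠ 0 := by positivity
  have hL := Real.logb_le_logb_of_le (b := 2) (by norm_num) (by positivity) hle3
  rw [Real.logb_mul (by positivity) (by positivity), Real.logb_mul (by positivity) (by positivity),
    Real.logb_mul (by positivity) (by positivity), Real.logb_pow, Real.logb_pow, Real.logb_pow,
    Real.logb_pow, Real.logb_self_eq_one (by norm_num), Nat.cast_choose_two, Nat.cast_choose_two]
    at hL
  push_cast [Nat.cast_sub hkn] at hL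
  nlinarith
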